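/- Let k be an algebraically closed field of characteristic 0, let ℓ ≥ 2 and let ε ∈ k^× not be a root of unity. Then B(V(ε,ℓ)) = T(V(ε,ℓ)); that is, the defining ideal J(V(ε,ℓ)) is zero: for every n ≥ 2, the only element of the free algebra k⟨x_1,…,x_ℓ⟩ that is homogeneous of tensor degree n and is annihilated by every n-fold composition ∂_{i_1}∘⋯∘∂_{i_n} is 0. -/

import Mathlib

/-- The degree-`n` homogeneous component of the free algebra on `ℓ` generators. -/
noncomputable def degComp (k : Type*) [Field k] (ℓ n : ℕ) :
    Submodule k (FreeAlgebra k (Fin ℓ)) :=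
  (Submodule.span k (Set.range (FreeAlgebra.ι k : Fin ℓ → FreeAlgebra k (Fin ℓ)))) ^ n

/-- The algebra automorphism of the free algebra extending the action of the generator `g` of `ℤ`
on the block `V(ε,ℓ)`: `g·x_1 = ε x_1`, `g·x_j = ε x_j + x_{j-1}` (indices shifted by one). -/
noncomputable def blockAut (k : Type*) [Field k] (ℓ : ℕ) (ε : k) :
    FreeAlgebra k (Fin ℓ) →ₐ[k] FreeAlgebra k (Fin ℓ) :=
  FreeAlgebra.lift k fun j : Fin ℓ =>
    ε • FreeAlgebra.ι k j +
      if (j : ℕ) = 0 then 0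
      else FreeAlgebra.ι k
        (⟨(j : ℕ) - 1, Nat.lt_of_le_of_lt (Nat.sub_le _ _) j.isLt⟩ : Fin ℓ)

section BlockNichols

open FreeAlgebra

variable {k : Type*} [Field k] {ℓ : ℕ}

theorem mem_degComp_one_iff {x : FreeAlgebra k (Fin ℓ)} :
    x ∈ degComp k ℓ 1 ↔ ∃ c : Fin ℓ → k, ∑ j, c j • ι k j = x := by
  rw [degComp, pow_one, Submodule.mem_span_range_iff_exists_fun]

theorem ι_mem_degComp_one (j : Fin ℓ) : ι k j ∈ degComp k ℓ 1 := by
  rw [degComp, pow_one]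
  exact Submodule.subset_span ⟨j, rfl⟩

theorem mul_mem_degComp {m n : ℕ} {u v : FreeAlgebra k (Fin ℓ)}
    (hu : u ∈ degComp k ℓ m) (hv : v ∈ degComp k ℓ n) : u * v ∈ degComp k ℓ (m + n) := by
  rw [degComp, pow_add]
  exact Submodule.mul_mem_mul hu hv

theorem mem_degComp_zero_iff {x : FreeAlgebra k (Fin ℓ)} :
    x ∈ degComp k ℓ 0 ↔ ∃ c : k, c • (1 : FreeAlgebra k (Fin ℓ)) = x := by
  rw [degComp, pow_zero, Submodule.one_eq_span, Submodule.mem_span_singleton]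

/-- A homogeneous element of positive degree is a combination of its first letters. -/
theorem exists_eq_sum_ι_mul {n : ℕ} {x : FreeAlgebra k (Fin ℓ)} (hx : x ∈ degComp k ℓ (n + 1)) :
    ∃ u : Fin ℓ → FreeAlgebra k (Fin ℓ), (∀ j, u j ∈ degComp k ℓ n) ∧
      x = ∑ j, ι k j * u j := by
  rw [degComp, pow_succ'] at hx
  refine Submodule.mul_induction_on hx (fun y hy u hu => ?_) ?_
  · obtain ⟨c, rfl⟩ := (Submodule.mem_span_range_iff_exists_fun k).1 hy
    exact ⟨fun j => c j • u, fun j => Submodule.smul_mem _ _ hu, by simp [Finset.sum_mul]⟩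
  · rintro _ _ ⟨u, hu, rfl⟩ ⟨v, hv, rfl⟩
    exact ⟨u + v, fun j => add_mem (hu j) (hv j), by simp [mul_add, Finset.sum_add_distrib]⟩

/-- The first letter can be stripped off linearly. -/
theorem exists_stripLeft (i : Fin ℓ) :
    ∃ L : FreeAlgebra k (Fin ℓ) →ₗ[k] FreeAlgebra k (Fin ℓ),
      ∀ j u, L (ι k j * u) = if i = j then u else 0 := by
  let M : FreeAlgebra k (Fin ℓ) →ₐ[k] Matrix (Fin 2) (Fin 2) (FreeAlgebra k (Fin ℓ)) :=
    lift k fun j => !![0, if i = j then 1 else 0; 0, ι k j]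
  have hM : ∀ u, M u 1 0 = 0 ∧ M u 1 1 = u := by
    intro u
    induction u using FreeAlgebra.induction with
    | grade0 r => simp [Matrix.algebraMap_matrix_apply]
    | grade1 j => simp [M]
    | mul a b ha hb => simp [Matrix.mul_apply, Fin.sum_univ_two, ha, hb]
    | add a b ha hb => simp [ha, hb]
  refine ⟨Matrix.entryLinearMap k _ 0 1 ∘ₗ M.toLinearMap, fun j u => ?_⟩
  have hMu := (hM u).2
  have hMj : M (ι k j) = !![0, if i = j then 1 else 0; 0, ι k j] := lift_ι_apply _ _
  simp [-Matrix.cons_mul, Matrix.mul_apply, Fin.sum_univ_two, hMu, hMj]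

/-- The last letter can be stripped off linearly. -/
theorem exists_stripRight (i : Fin ℓ) :
    ∃ L : FreeAlgebra k (Fin ℓ) →ₗ[k] FreeAlgebra k (Fin ℓ),
      ∀ j u, L (u * ι k j) = if i = j then u else 0 := by
  let M : FreeAlgebra k (Fin ℓ) →ₐ[k] Matrix (Fin 2) (Fin 2) (FreeAlgebra k (Fin ℓ)) :=
    lift k fun j => !![ι k j, if i = j then 1 else 0; 0, 0]
  have hM : ∀ u, M u 1 0 = 0 ∧ M u 0 0 = u := by
    intro u
    induction u using FreeAlgebra.induction with
    | grade0 r => simp [Matrix.algebraMap_matrix_apply]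
    | grade1 j => simp [M]
    | mul a b ha hb => simp [Matrix.mul_apply, Fin.sum_univ_two, ha, hb]
    | add a b ha hb => simp [ha, hb]
  refine ⟨Matrix.entryLinearMap k _ 0 1 ∘ₗ M.toLinearMap, fun j u => ?_⟩
  have hMu := (hM u).2
  have hMj : M (ι k j) = !![ι k j, if i = j then 1 else 0; 0, 0] := lift_ι_apply _ _
  simp [Matrix.mul_apply, Fin.sum_univ_two, hMu, hMj]

theorem eq_zero_of_sum_ι_mul_eq_zero {u : Fin ℓ → FreeAlgebra k (Fin ℓ)}
    (h : ∑ j, ι k j * u j = 0) (i : Fin ℓ) : u i = 0 := by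
  obtain ⟨L, hL⟩ := exists_stripLeft (k := k) i
  simpa [hL] using congrArg L h

/-- The operator moving the first letter to the end and twisting the other letters by `g`. -/
theorem exists_moveFirst (g : FreeAlgebra k (Fin ℓ) →ₐ[k] FreeAlgebra k (Fin ℓ)) :
    ∃ C : FreeAlgebra k (Fin ℓ) →ₗ[k] FreeAlgebra k (Fin ℓ),
      ∀ j u, C (ι k j * u) = g u * ι k j := by
  choose L hL using exists_stripLeft (k := k) (ℓ := ℓ)
  refine ⟨∑ j, LinearMap.mulRight k (ι k j) ∘ₗ g.toLinearMap ∘ₗ L j, fun j u => ?_⟩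
  simp only [LinearMap.sum_apply, LinearMap.comp_apply, hL]
  rw [Finset.sum_eq_single j] <;> simp +contextual

/-- The operator moving the first letter to the penultimate position and then applying `g`. -/
theorem exists_movePenultimate (g : FreeAlgebra k (Fin ℓ) →ₐ[k] FreeAlgebra k (Fin ℓ)) :
    ∃ R : FreeAlgebra k (Fin ℓ) →ₗ[k] FreeAlgebra k (Fin ℓ),
      ∀ y ∈ degComp k ℓ 1, ∀ v, ∀ z ∈ degComp k ℓ 1, R (y * v * z) = g (v * y * z) := by
  choose L hL using exists_stripLeft (k := k) (ℓ := ℓ)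
  choose L' hL' using exists_stripRight (k := k) (ℓ := ℓ)
  refine ⟨∑ j, ∑ i, g.toLinearMap ∘ₗ LinearMap.mulRight k (ι k j * ι k i) ∘ₗ L' i ∘ₗ L j, ?_⟩
  intro y hy v z hz
  obtain ⟨c, rfl⟩ := mem_degComp_one_iff.1 hy
  obtain ⟨d, rfl⟩ := mem_degComp_one_iff.1 hz
  simp only [Finset.sum_mul, Finset.mul_sum, map_sum, smul_mul_assoc, mul_smul_comm, map_smul]
  refine Finset.sum_congr rfl fun i _ => congrArg _ (Finset.sum_congr rfl fun j _ =>
    congrArg _ ?_)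
  simp only [LinearMap.sum_apply, LinearMap.comp_apply, hL, mul_assoc]
  rw [Finset.sum_eq_single j, Finset.sum_eq_single i] <;>
    simp +contextual [hL', ← mul_assoc, -map_mul]

theorem movePenultimate_pow {g : FreeAlgebra k (Fin ℓ) →ₐ[k] FreeAlgebra k (Fin ℓ)}
    (hg : ∀ n, ∀ u ∈ degComp k ℓ n, g u ∈ degComp k ℓ n)
    {R : FreeAlgebra k (Fin ℓ) →ₗ[k] FreeAlgebra k (Fin ℓ)}
    (hR : ∀ y ∈ degComp k ℓ 1, ∀ v, ∀ z ∈ degComp k ℓ 1, R (y * v * z) = g (v * y * z))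
    (m : ℕ) {a : FreeAlgebra k (Fin ℓ)} (ha : a ∈ degComp k ℓ m) (b : FreeAlgebra k (Fin ℓ))
    {z : FreeAlgebra k (Fin ℓ)} (hz : z ∈ degComp k ℓ 1) :
    (R ^ m) (a * b * z) = ((g.toLinearMap : Module.End k _) ^ m) (b * a * z) := by
  induction m generalizing a b z with
  | zero =>
    obtain ⟨c, rfl⟩ := mem_degComp_zero_iff.1 ha
    simp
  | succ m ih =>
    obtain ⟨u, hu, rfl⟩ := exists_eq_sum_ι_mul ha
    simp only [Finset.sum_mul, Finset.mul_sum, map_sum]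
    refine Finset.sum_congr rfl fun j _ => ?_
    have h := hR _ (ι_mem_degComp_one j) (u j * b) z hz
    rw [pow_succ, pow_succ, Module.End.mul_apply, Module.End.mul_apply, mul_assoc (ι k j), h]
    have h2 : g (u j * b * ι k j * z) = g (u j) * g (b * ι k j) * g z := by
      simp only [map_mul, mul_assoc]
    rw [h2, ih (hg m _ (hu j)) _ (hg 1 z hz)]
    simp only [AlgHom.toLinearMap_apply, map_mul, mul_assoc]

theorem algHom_mem_degComp {g : FreeAlgebra k (Fin ℓ) →ₐ[k] FreeAlgebra k (Fin ℓ)}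
    (hg : ∀ j, g (ι k j) ∈ degComp k ℓ 1) (n : ℕ) {u : FreeAlgebra k (Fin ℓ)}
    (hu : u ∈ degComp k ℓ n) : g u ∈ degComp k ℓ n := by
  induction n generalizing u with
  | zero =>
    obtain ⟨c, rfl⟩ := mem_degComp_zero_iff.1 hu
    simpa using hu
  | succ n ih =>
    obtain ⟨v, hv, rfl⟩ := exists_eq_sum_ι_mul hu
    rw [map_sum, add_comm n 1]
    exact sum_mem fun j _ => by rw [map_mul]; exact mul_mem_degComp (hg j) (ih (hv j))

/-- Products of generalized eigenvectors of an algebra endomorphism are generalized eigenvectors. -/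
theorem sub_algebraMap_pow_apply_mul_eq_zero {A : Type*} [Ring A] [Algebra k A]
    (g : A →ₐ[k] A) {α β : k}
    (N p q : ℕ) (hN : p + q ≤ N) {a b : A}
    (ha : ((g.toLinearMap - algebraMap k (Module.End k A) α) ^ p) a = 0)
    (hb : ((g.toLinearMap - algebraMap k (Module.End k A) β) ^ q) b = 0) :
    ((g.toLinearMap - algebraMap k (Module.End k A) (α * β)) ^ N) (a * b) = 0 := by
  induction N generalizing p q a b with
  | zero =>
    obtain rfl : p = 0 := by omega
    have : a = 0 := by simpa using ha
    simp [this]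
  | succ N ih =>
    rcases p with _ | p
    · have : a = 0 := by simpa using ha
      simp [this]
    rcases q with _ | q
    · have : b = 0 := by simpa using hb
      simp [this]
    have hcomm : Commute (g.toLinearMap : Module.End k A)
        ((g.toLinearMap - algebraMap k (Module.End k A) β) ^ (q + 1)) :=
      ((Commute.refl _).sub_right (Algebra.commute_algebraMap_right β _)).pow_right _
    have hgb : ((g.toLinearMap - algebraMap k (Module.End k A) β) ^ (q + 1)) (g b) = 0 := by
      have := LinearMap.congr_fun hcomm.eq b
      rw [Module.End.mul_apply, Module.End.mul_apply, hb, map_zero] at this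
      exact this.symm
    have hab : (g.toLinearMap - algebraMap k (Module.End k A) (α * β)) (a * b) =
        (g.toLinearMap - algebraMap k (Module.End k A) α) a * g b +
          α • (a * (g.toLinearMap - algebraMap k (Module.End k A) β) b) := by
      simp [Module.algebraMap_end_apply, sub_mul, mul_sub, smul_sub, smul_smul, mul_comm α β]
    rw [pow_succ, Module.End.mul_apply, hab, map_add, map_smul]
    rw [pow_succ, Module.End.mul_apply] at ha
    rw [ih p (q + 1) (by omega) ha hgb]
    rw [ih (p + 1) q (by omega) (a := a)]
    · simp
    · rwa [pow_succ, Module.End.mul_apply]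
    · rwa [pow_succ, Module.End.mul_apply] at hb

theorem eq_zero_of_pow_fixed_of_generalized {M : Type*} [AddCommGroup M] [Module k M]
    (f : Module.End k M) {α : k} {m : ℕ} (hα : α ^ m ≠ 1) (N : ℕ) {z : M}
    (hz : ((f - algebraMap k (Module.End k M) α) ^ N) z = 0) (hfix : (f ^ m) z = z) : z = 0 := by
  induction N generalizing z with
  | zero => simpa using hz
  | succ N ih =>
    rw [pow_succ, Module.End.mul_apply] at hz
    have hcomm : Commute (f ^ m) (f - algebraMap k (Module.End k M) α) :=
      ((Commute.refl f).sub_right (Algebra.commute_algebraMap_right α _)).pow_left _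
    have h0 := ih hz (by rw [← Module.End.mul_apply, hcomm.eq, Module.End.mul_apply, hfix])
    have hfz : f z = α • z := by
      simpa [sub_eq_zero, Module.algebraMap_end_apply] using h0
    have hpow : ∀ r : ℕ, (f ^ r) z = α ^ r • z := by
      intro r
      induction r with
      | zero => simp
      | succ r ihr => rw [pow_succ, Module.End.mul_apply, hfz, map_smul, ihr, smul_smul, pow_succ']
    rw [hpow] at hfix
    have : (α ^ m - 1) • z = 0 := by rw [sub_smul, hfix, one_smul, sub_self]
    exact (smul_eq_zero.1 this).resolve_left (sub_ne_zero.2 hα)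

theorem blockAut_ι (ε : k) (j : Fin ℓ) : blockAut k ℓ ε (ι k j) = ε • ι k j +
    if (j : ℕ) = 0 then 0
    else ι k (⟨(j : ℕ) - 1, Nat.lt_of_le_of_lt (Nat.sub_le _ _) j.isLt⟩ : Fin ℓ) := by
  simp [blockAut]

theorem blockAut_ι_mem (ε : k) (j : Fin ℓ) : blockAut k ℓ ε (ι k j) ∈ degComp k ℓ 1 := by
  rw [blockAut_ι]
  refine add_mem (Submodule.smul_mem _ _ (ι_mem_degComp_one j)) ?_
  split_ifs
  · exact zero_mem _
  · exact ι_mem_degComp_one _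

theorem blockAut_sub_algebraMap_pow_ι (ε : k) (r : ℕ) (j : Fin ℓ) (hj : (j : ℕ) < r) :
    (((blockAut k ℓ ε).toLinearMap - algebraMap k (Module.End k (FreeAlgebra k (Fin ℓ))) ε) ^ r)
      (ι k j) = 0 := by
  induction r generalizing j with
  | zero => omega
  | succ r ih =>
    rw [pow_succ, Module.End.mul_apply, LinearMap.sub_apply, AlgHom.toLinearMap_apply, blockAut_ι,
      Module.algebraMap_end_apply, add_sub_cancel_left]
    split_ifs with h
    · simp
    · exact ih _ (by simp; omega)

theorem blockAut_sub_algebraMap_pow (ε : k) (n : ℕ) {u : FreeAlgebra k (Fin ℓ)}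
    (hu : u ∈ degComp k ℓ n) :
    (((blockAut k ℓ ε).toLinearMap - algebraMap k (Module.End k (FreeAlgebra k (Fin ℓ))) (ε ^ n)) ^
      (n * ℓ + 1)) u = 0 := by
  induction n generalizing u with
  | zero =>
    obtain ⟨c, rfl⟩ := mem_degComp_zero_iff.1 hu
    simp
  | succ n ih =>
    obtain ⟨v, hv, rfl⟩ := exists_eq_sum_ι_mul hu
    rw [map_sum, pow_succ' ε]
    exact Finset.sum_eq_zero fun j _ => sub_algebraMap_pow_apply_mul_eq_zero _ _ ℓ (n * ℓ + 1)
      (by rw [add_mul]; omega) (blockAut_sub_algebraMap_pow_ι ε ℓ j j.isLt) (ih (hv j))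

/-- The operator `u ↦ ∑ i, ∂_i(u) y x_i`; for `y = 1` it is the last factor of the quantum
symmetrizer. -/
noncomputable def insertSum (D : Fin ℓ → (FreeAlgebra k (Fin ℓ) →ₗ[k] FreeAlgebra k (Fin ℓ)))
    (y : FreeAlgebra k (Fin ℓ)) : FreeAlgebra k (Fin ℓ) →ₗ[k] FreeAlgebra k (Fin ℓ) :=
  ∑ i, LinearMap.mulRight k (y * ι k i) ∘ₗ D i

section SkewDerivation

variable {g : FreeAlgebra k (Fin ℓ) →ₐ[k] FreeAlgebra k (Fin ℓ)}
  {D : Fin ℓ → (FreeAlgebra k (Fin ℓ) →ₗ[k] FreeAlgebra k (Fin ℓ))}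

theorem insertSum_apply (y u : FreeAlgebra k (Fin ℓ)) :
    insertSum D y u = ∑ i, D i u * (y * ι k i) := by
  simp [insertSum, LinearMap.sum_apply, -LinearMap.mulRight_mul]

theorem insertSum_ι (hDx : ∀ i j, D i (ι k j) = if i = j then 1 else 0)
    (y : FreeAlgebra k (Fin ℓ)) (j : Fin ℓ) : insertSum D y (ι k j) = y * ι k j := by
  simp [insertSum_apply, hDx]

theorem insertSum_degComp_one (hDx : ∀ i j, D i (ι k j) = if i = j then 1 else 0)
    (y : FreeAlgebra k (Fin ℓ)) {v : FreeAlgebra k (Fin ℓ)} (hv : v ∈ degComp k ℓ 1) :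
    insertSum D y v = y * v := by
  obtain ⟨c, rfl⟩ := mem_degComp_one_iff.1 hv
  simp [insertSum_ι hDx, Finset.mul_sum]

theorem insertSum_mul (hDmul : ∀ i u v, D i (u * v) = D i u * g v + u * D i v)
    (y u v : FreeAlgebra k (Fin ℓ)) :
    insertSum D y (u * v) = insertSum D (g v * y) u + u * insertSum D y v := by
  simp [insertSum_apply, hDmul, add_mul, Finset.sum_add_distrib, Finset.mul_sum, mul_assoc]

theorem insertSum_equivariant (hg : ∀ j, g (ι k j) ∈ degComp k ℓ 1)
    (hD1 : ∀ i, D i 1 = 0) (hDx : ∀ i j, D i (ι k j) = if i = j then 1 else 0)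
    (hDmul : ∀ i u v, D i (u * v) = D i u * g v + u * D i v) (y u : FreeAlgebra k (Fin ℓ)) :
    insertSum D (g y) (g u) = g (insertSum D y u) := by
  induction u using FreeAlgebra.induction generalizing y with
  | grade0 r => simp [Algebra.algebraMap_eq_smul_one, insertSum_apply, hD1]
  | grade1 j => rw [insertSum_ι hDx, insertSum_degComp_one hDx _ (hg j), map_mul]
  | mul a b ha hb =>
    rw [map_mul, insertSum_mul hDmul, insertSum_mul hDmul, ← map_mul, ha, hb, map_add, map_mul]
  | add a b ha hb => simp [ha, hb]

theorem skewDer_mem_degComp (hg : ∀ j, g (ι k j) ∈ degComp k ℓ 1)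
    (hDx : ∀ i j, D i (ι k j) = if i = j then 1 else 0)
    (hDmul : ∀ i u v, D i (u * v) = D i u * g v + u * D i v) (i : Fin ℓ) (n : ℕ)
    {x : FreeAlgebra k (Fin ℓ)} (hx : x ∈ degComp k ℓ (n + 1)) : D i x ∈ degComp k ℓ n := by
  induction n generalizing x with
  | zero =>
    obtain ⟨c, rfl⟩ := mem_degComp_one_iff.1 hx
    rw [mem_degComp_zero_iff]
    exact ⟨c i, by simp [hDx]⟩
  | succ n ih =>
    obtain ⟨u, hu, rfl⟩ := exists_eq_sum_ι_mul hx
    rw [map_sum]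
    refine sum_mem fun j _ => ?_
    rw [hDmul, hDx]
    refine add_mem ?_ ?_
    · split_ifs
      · simpa using algHom_mem_degComp hg _ (hu j)
      · simp
    · rw [add_comm n 1]
      exact mul_mem_degComp (ι_mem_degComp_one j) (ih (hu j))

theorem insertSum_one_mem_degComp (hg : ∀ j, g (ι k j) ∈ degComp k ℓ 1)
    (hDx : ∀ i j, D i (ι k j) = if i = j then 1 else 0)
    (hDmul : ∀ i u v, D i (u * v) = D i u * g v + u * D i v) (n : ℕ)
    {x : FreeAlgebra k (Fin ℓ)} (hx : x ∈ degComp k ℓ (n + 1)) :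
    insertSum D 1 x ∈ degComp k ℓ (n + 1) := by
  rw [insertSum_apply]
  refine sum_mem fun i _ => ?_
  rw [one_mul]
  exact mul_mem_degComp (skewDer_mem_degComp hg hDx hDmul i n hx) (ι_mem_degComp_one i)

/-- The factorization `S (1 - C) = (1 - R) S'`, where `S = insertSum D 1`, `C` moves the first
letter to the end, and `S'` is `S` applied to all letters but the first. -/
theorem insertSum_sub_moveFirst (hg : ∀ j, g (ι k j) ∈ degComp k ℓ 1)
    (hD1 : ∀ i, D i 1 = 0) (hDx : ∀ i j, D i (ι k j) = if i = j then 1 else 0)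
    (hDmul : ∀ i u v, D i (u * v) = D i u * g v + u * D i v)
    {R : FreeAlgebra k (Fin ℓ) →ₗ[k] FreeAlgebra k (Fin ℓ)}
    (hR : ∀ y ∈ degComp k ℓ 1, ∀ v, ∀ z ∈ degComp k ℓ 1, R (y * v * z) = g (v * y * z))
    (j : Fin ℓ) (u : FreeAlgebra k (Fin ℓ)) :
    insertSum D 1 (ι k j * u) - insertSum D 1 (g u * ι k j) =
      ι k j * insertSum D 1 u - R (ι k j * insertSum D 1 u) := by
  have hR' : R (ι k j * insertSum D 1 u) = insertSum D (g (ι k j)) (g u) := by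
    rw [insertSum_equivariant hg hD1 hDx hDmul, insertSum_apply, insertSum_apply, Finset.mul_sum,
      map_sum, map_sum]
    refine Finset.sum_congr rfl fun i _ => ?_
    rw [one_mul, ← mul_assoc, hR _ (ι_mem_degComp_one j) _ _ (ι_mem_degComp_one i), mul_assoc]
  rw [hR', insertSum_mul hDmul, insertSum_mul hDmul, insertSum_ι hDx, insertSum_ι hDx]
  simp only [mul_one, one_mul]
  abel

end SkewDerivation

theorem eq_zero_of_insertSum_one_eq_zero {ε : k} (hroot : ∀ m : ℕ, 0 < m → ε ^ m ≠ 1)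
    {D : Fin ℓ → (FreeAlgebra k (Fin ℓ) →ₗ[k] FreeAlgebra k (Fin ℓ))}
    (hD1 : ∀ i, D i 1 = 0) (hDx : ∀ i j, D i (ι k j) = if i = j then 1 else 0)
    (hDmul : ∀ i u v, D i (u * v) = D i u * blockAut k ℓ ε v + u * D i v) (n : ℕ)
    {x : FreeAlgebra k (Fin ℓ)} (hx : x ∈ degComp k ℓ (n + 1)) (h : insertSum D 1 x = 0) :
    x = 0 := by
  induction n generalizing x with
  | zero => simpa [insertSum_degComp_one hDx _ hx] using h
  | succ n ih =>
    have hg := blockAut_ι_mem (ℓ := ℓ) ε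
    obtain ⟨C, hC⟩ := exists_moveFirst (blockAut k ℓ ε)
    obtain ⟨R, hR⟩ := exists_movePenultimate (blockAut k ℓ ε)
    have hfix : ∀ z ∈ degComp k ℓ (n + 2), R z = z → z = 0 := by
      intro z hz hRz
      refine eq_zero_of_pow_fixed_of_generalized (blockAut k ℓ ε).toLinearMap (m := n + 1)
        (by rw [← pow_mul]; exact hroot ((n + 2) * (n + 1)) (by positivity)) _
        (blockAut_sub_algebraMap_pow ε _ hz) ?_
      have hpow : (R ^ (n + 1)) z = ((blockAut k ℓ ε).toLinearMap ^ (n + 1)) z := by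
        rw [degComp, pow_succ] at hz
        refine Submodule.mul_induction_on hz (fun a ha y hy => ?_)
          fun a b ha hb => by rw [map_add, map_add, ha, hb]
        have := movePenultimate_pow (fun n u hu => algHom_mem_degComp hg n hu) hR (n + 1) ha 1
          (z := y) (by rwa [degComp, pow_one])
        simpa using this
      rw [← hpow, Module.End.pow_apply]
      exact Function.iterate_fixed hRz _
    have hCmem : ∀ z ∈ degComp k ℓ (n + 2), C z ∈ degComp k ℓ (n + 2) := by
      intro z hz
      obtain ⟨u, hu, rfl⟩ := exists_eq_sum_ι_mul hz
      rw [map_sum]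
      refine sum_mem fun j _ => ?_
      rw [hC]
      exact mul_mem_degComp (n := 1) (algHom_mem_degComp hg (n + 1) (hu j)) (ι_mem_degComp_one j)
    have hinj : ∀ z ∈ degComp k ℓ (n + 2), insertSum D 1 (z - C z) = 0 → z = 0 := by
      intro z hz h0
      obtain ⟨u, hu, rfl⟩ := exists_eq_sum_ι_mul hz
      have hSu : ∑ j, ι k j * insertSum D 1 (u j) = 0 := by
        refine hfix _ (sum_mem fun j _ => ?_) ?_
        · rw [add_comm (n + 1) 1]
          exact mul_mem_degComp (ι_mem_degComp_one j)
            (insertSum_one_mem_degComp hg hDx hDmul n (hu j))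
        · simp only [map_sub, map_sum, hC, ← Finset.sum_sub_distrib,
            insertSum_sub_moveFirst hg hD1 hDx hDmul hR] at h0
          rw [Finset.sum_sub_distrib, sub_eq_zero] at h0
          rw [map_sum, ← h0]
      refine Finset.sum_eq_zero fun j _ => ?_
      rw [ih (hu j) (eq_zero_of_sum_ι_mul_eq_zero hSu j), mul_zero]
    have : FiniteDimensional k (degComp k ℓ (n + 2)) := Module.Finite.iff_fg.2
      (Submodule.FG.pow (Submodule.fg_span (Set.finite_range _)) _)
    let L : degComp k ℓ (n + 2) →ₗ[k] degComp k ℓ (n + 2) :=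
      (LinearMap.id - C).restrict fun z hz => sub_mem hz (hCmem z hz)
    have hL : Function.Injective L := by
      rw [injective_iff_map_eq_zero]
      intro z hz
      refine Subtype.ext (hinj z z.2 ?_)
      have : (z : FreeAlgebra k (Fin ℓ)) - C z = 0 := congrArg Subtype.val hz
      rw [this, map_zero]
    obtain ⟨z, hz⟩ := LinearMap.injective_iff_surjective.1 hL ⟨x, hx⟩
    have hzx : (z : FreeAlgebra k (Fin ℓ)) - C z = x := congrArg Subtype.val hz
    rw [← hzx, hinj z z.2 (by rw [hzx, h])]
    simp

end BlockNichols

/-- If `ε` is not a root of unity, then `B(V(ε,ℓ)) = T(V(ε,ℓ))`: for every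
`n ≥ 2` the only element of the free algebra homogeneous of tensor degree `n` annihilated by
every `n`-fold composition of the skew derivations is `0`. -/
theorem statement4 (k : Type*) [Field k] [IsAlgClosed k] [CharZero k]
    (ℓ : ℕ) (hℓ : 2 ≤ ℓ) (ε : k) (hε : ε ≠ 0)
    (hroot : ∀ m : ℕ, 0 < m → ε ^ m ≠ 1)
    (D : Fin ℓ → (FreeAlgebra k (Fin ℓ) →ₗ[k] FreeAlgebra k (Fin ℓ)))
    (hD1 : ∀ i, D i (1 : FreeAlgebra k (Fin ℓ)) = 0)
    (hDx : ∀ i j, D i (FreeAlgebra.ι k j) = if i = j then 1 else 0)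
    (hDmul : ∀ i (u v : FreeAlgebra k (Fin ℓ)),
      D i (u * v) = D i u * blockAut k ℓ ε v + u * D i v) :
    ∀ n : ℕ, 2 ≤ n → ∀ x ∈ degComp k ℓ n,
      (∀ l : List (Fin ℓ), l.length = n → l.foldr (fun i y => D i y) x = 0) → x = 0 := by
  have key : ∀ n : ℕ, ∀ x ∈ degComp k ℓ n,
      (∀ l : List (Fin ℓ), l.length = n → l.foldr (fun i y => D i y) x = 0) → x = 0 := by
    intro n
    induction n with
    | zero => exact fun x _ h => h [] rfl
    | succ n ih =>
      intro x hx h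
      refine eq_zero_of_insertSum_one_eq_zero hroot hD1 hDx hDmul n hx ?_
      rw [insertSum_apply]
      refine Finset.sum_eq_zero fun i _ => ?_
      rw [ih (D i x) (skewDer_mem_degComp (blockAut_ι_mem ε) hDx hDmul i n hx), zero_mul]
      intro l hl
      simpa using h (l ++ [i]) (by simp [hl])
  exact fun n _ => key n
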